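/- Let X ⊂ ℙ^r be an integral and non-degenerate projective variety of dimension n over an algebraically closed field of characteristic 0. Assume dim σ_{k+1}(X) = (k+1)(n+1)−1 ≤ r and that the k-th secant degree α_k is greater than 1. Then for a general q ∈ σ_{k+1}(X), for any A ∈ S(q,X) and any a ∈ A, there are at least α_k distinct elements B_1, …, B_{α_k} ∈ S(q,X) (one of them equal to A) with a ∈ B_i for every i. (This statement holds over an algebraically closed field of arbitrary characteristic.) -/

import Mathlib

noncomputable section

namespace ContactLoci

variable {K : Type*} [Field K] {ι : Type*} [Fintype ι]

/-- Projective space over `K` with homogeneous coordinates indexed by `ι`. -/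
abbrev PP (K : Type*) [Field K] (ι : Type*) : Type _ :=
  Projectivization K (ι → K)

/-- The affine cone over a set of projective points. -/
def coneOf (S : Set (PP K ι)) : Set (ι → K) :=
  ⋃ x ∈ S, (x.submodule : Set (ι → K))

/-- The linear span, in the underlying vector space, of the cone over `S`. -/
def vspan (S : Set (PP K ι)) : Submodule K (ι → K) :=
  Submodule.span K (coneOf S)

/-- The projective linear span of a set of projective points. -/
def projSpan (S : Set (PP K ι)) : Set (PP K ι) :=
  {x | x.submodule ≤ vspan S}

/-- The projective dimension of the linear span of `S` (`-1` for `S = ∅`). -/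
def projDim (S : Set (PP K ι)) : ℤ :=
  (Module.finrank K (vspan S) : ℤ) - 1

/-- A set of projective points is non-degenerate if its linear span is everything. -/
def Nondegenerate (S : Set (PP K ι)) : Prop :=
  vspan S = ⊤

/-- The common zero locus in projective space of a set of polynomials. -/
def zeroLocus (S : Set (MvPolynomial ι K)) : Set (PP K ι) :=
  {x | ∀ f ∈ S, ∀ v ∈ x.submodule, MvPolynomial.eval v f = 0}

/-- Zariski-closed subsets of projective space: common zero loci of sets of
homogeneous polynomials. -/
def IsZClosed (X : Set (PP K ι)) : Prop :=
  ∃ S : Set (MvPolynomial ι K), (∀ f ∈ S, ∃ d : ℕ, f.IsHomogeneous d) ∧ X = zeroLocus S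

/-- Zariski closure. -/
def zclosure (S : Set (PP K ι)) : Set (PP K ι) :=
  ⋂₀ {Y | IsZClosed Y ∧ S ⊆ Y}

/-- Irreducibility with respect to the Zariski topology. -/
def IsZIrreducible (S : Set (PP K ι)) : Prop :=
  S.Nonempty ∧ ∀ Y Z : Set (PP K ι), IsZClosed Y → IsZClosed Z → S ⊆ Y ∪ Z → S ⊆ Y ∨ S ⊆ Z

/-- An integral projective variety: a Zariski-closed irreducible subset. -/
def IsIntegralVariety (X : Set (PP K ι)) : Prop :=
  IsZClosed X ∧ IsZIrreducible X

/-- `C` is an irreducible component of `S`: a maximal irreducible subset of `S`. -/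
def IsZIrredComponent (S C : Set (PP K ι)) : Prop :=
  IsZIrreducible C ∧ C ⊆ S ∧ ∀ D : Set (PP K ι), IsZIrreducible D → D ⊆ S → C ⊆ D → C = D

/-- The dimension of a set: the Krull dimension of the poset of irreducible
Zariski-closed subsets of its Zariski closure (`⊥` for the empty set). -/
def zdim (S : Set (PP K ι)) : WithBot ℕ∞ :=
  Order.krullDim ({Y : Set (PP K ι) // IsZClosed Y ∧ IsZIrreducible Y ∧ Y ⊆ zclosure S})

/-- A property holds at a general point of `X`: it holds away from a proper
Zariski-closed subset. -/
def HoldsGenerically (X : Set (PP K ι)) (P : PP K ι → Prop) : Prop :=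
  ∃ Y : Set (PP K ι), IsZClosed Y ∧ ¬X ⊆ Y ∧ ∀ x ∈ X \ Y, P x

/-- Zero locus of multihomogeneous polynomials in a self-product of projective space. -/
def multiZeroLocus {m : ℕ} (S : Set (MvPolynomial (Fin m × ι) K)) :
    Set (Fin m → PP K ι) :=
  {u | ∀ f ∈ S, ∀ v : Fin m → ι → K, (∀ i, v i ∈ (u i).submodule) →
    MvPolynomial.eval (fun p => v p.1 p.2) f = 0}

/-- Zariski-closed subsets of the `m`-fold self-product of projective space. -/
def IsMultiZClosed {m : ℕ} (T : Set (Fin m → PP K ι)) : Prop :=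
  ∃ S : Set (MvPolynomial (Fin m × ι) K),
    (∀ f ∈ S, ∀ i : Fin m, ∃ d : ℕ,
      MvPolynomial.IsWeightedHomogeneous (fun p : Fin m × ι => if p.1 = i then 1 else 0) f d) ∧
    T = multiZeroLocus S

/-- A property holds for a general `m`-tuple of points of `X`. -/
def HoldsForGeneralTuples (X : Set (PP K ι)) (m : ℕ) (P : (Fin m → PP K ι) → Prop) : Prop :=
  ∃ T : Set (Fin m → PP K ι), IsMultiZClosed T ∧
    (∃ u : Fin m → PP K ι, (∀ i, u i ∈ X) ∧ u ∉ T) ∧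
    ∀ u : Fin m → PP K ι, (∀ i, u i ∈ X) → u ∉ T → P u

/-- The homogeneous vanishing ideal of `X` (as a set of homogeneous polynomials). -/
def homogVanishingIdeal (X : Set (PP K ι)) : Set (MvPolynomial ι K) :=
  {f | (∃ d : ℕ, f.IsHomogeneous d) ∧ ∀ x ∈ X, ∀ v ∈ x.submodule, MvPolynomial.eval v f = 0}

/-- The embedded (projective) tangent space of `X` at `x`. -/
def embTangentSpace (X : Set (PP K ι)) (x : PP K ι) : Set (PP K ι) :=
  {y | ∀ f ∈ homogVanishingIdeal X,
    ∑ i : ι, y.rep i * MvPolynomial.eval x.rep (MvPolynomial.pderiv i f) = 0}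

/-- Smooth points of `X`. -/
def IsSmoothPoint (X : Set (PP K ι)) (x : PP K ι) : Prop :=
  x ∈ X ∧ zdim (embTangentSpace X x) = zdim X

/-- `M_A`: the linear span of the tangent spaces of `X` at the points of `A`. -/
def tangentSpan (X A : Set (PP K ι)) : Set (PP K ι) :=
  projSpan (⋃ a ∈ A, embTangentSpace X a)

/-- The locus of smooth points of `X` at which `M_A` is tangent to `X`. -/
def tangencyLocus (X A : Set (PP K ι)) : Set (PP K ι) :=
  {x | IsSmoothPoint X x ∧ embTangentSpace X x ⊆ tangentSpan X A}

/-- The tangential contact locus of `X` at `A`: the closure of the union of the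
irreducible components of the tangency locus meeting `A`. -/
def contactLocus (X A : Set (PP K ι)) : Set (PP K ι) :=
  zclosure (⋃ C ∈ {C : Set (PP K ι) |
    IsZIrredComponent (tangencyLocus X A) C ∧ (C ∩ A).Nonempty}, C)

/-- `X` is weakly `k`-defective: the tangential contact locus at `k` general points
has positive dimension. -/
def WeaklyDefective (X : Set (PP K ι)) (k : ℕ) : Prop :=
  HoldsForGeneralTuples X k fun u => 0 < zdim (contactLocus X (Set.range u))

/-- The `k`-th secant variety of `X`. -/
def secant (k : ℕ) (X : Set (PP K ι)) : Set (PP K ι) :=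
  zclosure {q | ∃ S : Finset (PP K ι), ↑S ⊆ X ∧ S.card = k ∧ q ∈ projSpan (S : Set (PP K ι))}

/-- The `X`-rank of a point. -/
def xrank (X : Set (PP K ι)) (q : PP K ι) : ℕ :=
  sInf {k | ∃ S : Finset (PP K ι), ↑S ⊆ X ∧ S.card = k ∧ q ∈ projSpan (S : Set (PP K ι))}

/-- `𝒮(q,X)`: the set of minimal `X`-decompositions of `q`. -/
def decompositions (X : Set (PP K ι)) (q : PP K ι) : Set (Finset (PP K ι)) :=
  {S | ↑S ⊆ X ∧ S.card = xrank X q ∧ q ∈ projSpan (S : Set (PP K ι))}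

/-- `X` is `k`-identifiable: a general point of `σ_k(X)` has a unique minimal
decomposition. -/
def Identifiable (X : Set (PP K ι)) (k : ℕ) : Prop :=
  HoldsGenerically (secant k X) fun q => ∃! S : Finset (PP K ι), S ∈ decompositions X q

/-- `α` is the `k`-th secant degree of `X`. -/
def HasSecantDegree (X : Set (PP K ι)) (k α : ℕ) : Prop :=
  HoldsGenerically (secant k X) fun q => (decompositions X q).ncard = α

/-- Projective linear subspaces. -/
def IsProjLinear (L : Set (PP K ι)) : Prop :=
  L = projSpan L

/-- Lines in projective space. -/
def IsLine (L : Set (PP K ι)) : Prop :=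
  IsProjLinear L ∧ Module.finrank K (vspan L) = 2

/-- `X` is uniruled by lines: through a general point of `X` there is a line
contained in `X`. -/
def UniruledByLines (X : Set (PP K ι)) : Prop :=
  HoldsGenerically X fun x => ∃ L : Set (PP K ι), IsLine L ∧ x ∈ L ∧ L ⊆ X

/-- The join of two sets in projective space. -/
def join (A B : Set (PP K ι)) : Set (PP K ι) :=
  zclosure (⋃ a ∈ A, ⋃ b ∈ B, projSpan {a, b})

/-- The linear space `M` is tangent to `X` along `W`. -/
def TangentAlong (M X W : Set (PP K ι)) : Prop :=
  ∀ x ∈ W, IsSmoothPoint X x → embTangentSpace X x ⊆ M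

/-- `S` has exactly `m` irreducible components, all of them projective linear
subspaces, and these components are linearly independent. -/
def ComponentsAreIndepLinear (S : Set (PP K ι)) (m : ℕ) : Prop :=
  ∃ C : Fin m → Set (PP K ι), Function.Injective C ∧
    (∀ D : Set (PP K ι), IsZIrredComponent S D ↔ ∃ i, D = C i) ∧
    (∀ i, IsProjLinear (C i)) ∧
    Module.finrank K (vspan S) = ∑ i, Module.finrank K (vspan (C i))


/-- The Segre variety: the image of `ℙ^{n 1} × ⋯ × ℙ^{n s}` under the Segre
embedding, given by the complete linear system `|O(1,…,1)|`. -/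
def segreVariety (K : Type*) [Field K] (s : ℕ) (n : Fin s → ℕ) :
    Set (PP K (∀ i : Fin s, Fin (n i + 1))) :=
  {x | ∃ u : ∀ i : Fin s, Fin (n i + 1) → K,
    x.submodule = Submodule.span K
      ({fun t => ∏ i, u i (t i)} : Set ((∀ i : Fin s, Fin (n i + 1)) → K))}

/-- The projection of `L ⊆ Segre` to the `i`-th factor is a single point, i.e. `L`
lies in a single fiber of the `i`-th projection. -/
def SegreFactorIsPoint (K : Type*) [Field K] (s : ℕ) (n : Fin s → ℕ) (i : Fin s)
    (L : Set (PP K (∀ j : Fin s, Fin (n j + 1)))) : Prop :=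
  ∃ w : Fin (n i + 1) → K, w ≠ 0 ∧ ∀ x ∈ L,
    ∃ u : ∀ j : Fin s, Fin (n j + 1) → K,
      x.submodule = Submodule.span K
        ({fun t => ∏ j, u j (t j)} : Set ((∀ j : Fin s, Fin (n j + 1)) → K)) ∧
      u i ∈ Submodule.span K ({w} : Set (Fin (n i + 1) → K))

/-- Index type for the Segre–Veronese embedding of multidegree `d`:
multi-indices of degree `d i` in the homogeneous variables of the `i`-th factor. -/
abbrev svIndex (s : ℕ) (n d : Fin s → ℕ) : Type :=
  ∀ i : Fin s, {w : Fin (n i + 1) → Fin (d i + 1) // ∑ j, (w j : ℕ) = d i}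

/-- The Segre–Veronese variety of multidegree `d`: the image of
`ℙ^{n 1} × ⋯ × ℙ^{n s}` under the embedding by `|L_1^{d 1} ⊗ ⋯ ⊗ L_s^{d s}|`. -/
def segreVeroneseVariety (K : Type*) [Field K] (s : ℕ) (n d : Fin s → ℕ) :
    Set (PP K (svIndex s n d)) :=
  {x | ∃ u : ∀ i : Fin s, Fin (n i + 1) → K,
    x.submodule = Submodule.span K
      ({fun t => ∏ i, ∏ j, u i j ^ ((t i).1 j : ℕ)} : Set (svIndex s n d → K))}

/-- The vector of the moments of degree `≤ d` of the one-dimensional Gaussian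
distribution with mean `μ` and variance `t`. -/
def gaussMomentVec (K : Type*) [Field K] (d : ℕ) (μ t : K) : Fin (d + 1) → K := fun i =>
  ∑ j ∈ Finset.range ((i : ℕ) / 2 + 1),
    ((Nat.choose (i : ℕ) (2 * j) * Nat.doubleFactorial (2 * j - 1) : ℕ) : K) *
      t ^ j * μ ^ ((i : ℕ) - 2 * j)

/-- The Gaussian moment variety `𝒢_{1,d} ⊆ ℙ^d`. -/
def gaussianMomentVariety (K : Type*) [Field K] (d : ℕ) : Set (PP K (Fin (d + 1))) :=
  zclosure {x | ∃ μ t : K,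
    x.submodule = Submodule.span K ({gaussMomentVec K d μ t} : Set (Fin (d + 1) → K))}

/-- Zariski-closed families of `m`-tuples of coefficient vectors of linear forms. -/
def IsAffineClosedFamily {m : ℕ} (T : Set (Fin m → ι → K)) : Prop :=
  ∃ S : Set (MvPolynomial (Fin m × ι) K),
    T = {h | ∀ f ∈ S, MvPolynomial.eval (fun p => h p.1 p.2) f = 0}

/-- The linear subspace cut out by the `m` linear forms with coefficient vectors `h`. -/
def linearSlice {m : ℕ} (h : Fin m → ι → K) : Set (PP K ι) :=
  {x | ∀ j : Fin m, ∑ i : ι, h j i * x.rep i = 0}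

/-- `x` lies on the hyperplane with coefficient vector `f`. -/
def inHyperplane (f : ι → K) (x : PP K ι) : Prop :=
  ∑ i : ι, f i * x.rep i = 0

/-- `X ⊆ ℙ^r` (of dimension `n`, `r + 1 = card ι`) is very strange: for a general
codimension-`n` linear subspace `M`, some `r - n + 2` points of `X ∩ M` lie in a
hyperplane of `M`, i.e. in a linear subspace of projective dimension `r - n - 1`. -/
def VeryStrange (n : ℕ) (X : Set (PP K ι)) : Prop :=
  ∃ T : Set (Fin n → ι → K), IsAffineClosedFamily T ∧ (∃ h, h ∉ T) ∧
    ∀ h : Fin n → ι → K, h ∉ T →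
      ∃ A : Finset (PP K ι), ↑A ⊆ X ∩ linearSlice h ∧
        A.card = Fintype.card ι + 1 - n ∧
        Module.finrank K (vspan (A : Set (PP K ι))) ≤ Fintype.card ι - 1 - n


/-- Vanishing of a polynomial on a set. -/
def Van {σ : Type*} (S : Set (σ → K)) (f : MvPolynomial σ K) : Prop :=
  ∀ s ∈ S, MvPolynomial.eval s f = 0

/-- Affine irreducibility. -/
def Irr {σ : Type*} (S : Set (σ → K)) : Prop :=
  S.Nonempty ∧ ∀ f g : MvPolynomial σ K, Van S (f * g) → Van S f ∨ Van S g

/-- Any `d+1` polynomials are algebraically dependent on `S`. -/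
def DLE {σ : Type*} (S : Set (σ → K)) (d : ℕ) : Prop :=
  ∀ g : Fin (d + 1) → MvPolynomial σ K, ∃ F : MvPolynomial (Fin (d + 1)) K, F ≠ 0 ∧
    ∀ s ∈ S, MvPolynomial.eval (fun i => MvPolynomial.eval s (g i)) F = 0

/-- affine Zariski closure -/
def acl {σ : Type*} (S : Set (σ → K)) : Set (σ → K) :=
  {v | ∀ f, Van S f → MvPolynomial.eval v f = 0}

lemma subset_acl {σ : Type*} (S : Set (σ → K)) : S ⊆ acl S := fun _ hs _ hf => hf _ hs

lemma Van.acl {σ : Type*} {S : Set (σ → K)} {f : MvPolynomial σ K} (h : Van S f) :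
    Van (acl S) f := fun _ hv => hv f h

lemma Irr.acl {σ : Type*} {S : Set (σ → K)} (h : Irr S) : Irr (acl S) := by
  refine ⟨h.1.mono (subset_acl S), fun f g hfg => ?_⟩
  rcases h.2 f g (fun s hs => hfg s (subset_acl S hs)) with h1 | h1
  · exact Or.inl h1.acl
  · exact Or.inr h1.acl

lemma eval_bind {σ τ : Type*} (g : τ → MvPolynomial σ K) (F : MvPolynomial τ K) (s : σ → K) :
    MvPolynomial.eval s (MvPolynomial.bind₁ g F) =
      MvPolynomial.eval (fun i => MvPolynomial.eval s (g i)) F := by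
  have := MvPolynomial.eval₂Hom_bind₁ (RingHom.id K) s g F
  exact this

lemma DLE.mono {σ : Type*} {S T : Set (σ → K)} {d : ℕ} (h : DLE T d) (hST : S ⊆ T) :
    DLE S d := fun g => by
  obtain ⟨F, hF, h1⟩ := h g
  exact ⟨F, hF, fun s hs => h1 s (hST hs)⟩

lemma DLE.acl {σ : Type*} {S : Set (σ → K)} {d : ℕ} (h : DLE S d) : DLE (acl S) d := fun g => by
  obtain ⟨F, hF, h1⟩ := h g
  refine ⟨F, hF, fun s hs => ?_⟩
  rw [← eval_bind]
  exact hs _ fun s hs => by rw [eval_bind]; exact h1 s hs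

lemma DLE.union {σ : Type*} {S T : Set (σ → K)} {d : ℕ} (hS : DLE S d) (hT : DLE T d) :
    DLE (S ∪ T) d := fun g => by
  obtain ⟨F, hF, h1⟩ := hS g
  obtain ⟨G, hG, h2⟩ := hT g
  refine ⟨F * G, mul_ne_zero hF hG, fun s hs => ?_⟩
  rcases hs with hs | hs
  · simp [h1 s hs]
  · simp [h2 s hs]

lemma DLE.image {σ τ : Type*} {S : Set (σ → K)} {d : ℕ} (h : DLE S d)
    (G : τ → MvPolynomial σ K) :
    DLE ((fun s i => MvPolynomial.eval s (G i)) '' S) d := fun g => by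
  obtain ⟨F, hF, h1⟩ := h (fun i => MvPolynomial.bind₁ G (g i))
  refine ⟨F, hF, ?_⟩
  rintro _ ⟨s, hs, rfl⟩
  simpa [eval_bind] using h1 s hs

lemma Irr.image {σ τ : Type*} {S : Set (σ → K)} (h : Irr S)
    (G : τ → MvPolynomial σ K) :
    Irr ((fun s i => MvPolynomial.eval s (G i)) '' S) := by
  refine ⟨h.1.image _, fun f g hfg => ?_⟩
  rcases h.2 (MvPolynomial.bind₁ G f) (MvPolynomial.bind₁ G g) (fun s hs => by
    have := hfg _ ⟨s, hs, rfl⟩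
    simpa [eval_bind] using this) with h1 | h1
  · left
    rintro _ ⟨s, hs, rfl⟩
    simpa [eval_bind] using h1 s hs
  · right
    rintro _ ⟨s, hs, rfl⟩
    simpa [eval_bind] using h1 s hs

lemma Irr.pow {σ : Type*} {S : Set (σ → K)} (h : Irr S) {f g : MvPolynomial σ K} (e : ℕ)
    (hf : ¬ Van S f) (hfg : Van S (f ^ e * g)) : Van S g := by
  induction e with
  | zero => simpa using hfg
  | succ e ih =>
    rw [pow_succ', mul_assoc] at hfg
    exact ih ((h.2 _ _ hfg).resolve_left hf)

lemma DLE.cut {σ : Type*} {S : Set (σ → K)} {d : ℕ} (hS : Irr S) (h : DLE S (d + 1))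
    (f : MvPolynomial σ K) (hf : ¬ Van S f) :
    DLE {s ∈ S | MvPolynomial.eval s f = 0} d := fun g => by
  obtain ⟨F, hF, h1⟩ := h (Fin.cons f g)
  set P := MvPolynomial.finSuccEquiv K (d + 1) F with hP
  have hP0 : P ≠ 0 := by
    rw [hP]; simpa using hF
  obtain ⟨Q, hPQ, hQ⟩ := Polynomial.exists_eq_pow_rootMultiplicity_mul_and_not_dvd P hP0 0
  rw [Polynomial.C_0, sub_zero] at hPQ hQ
  rw [Polynomial.X_dvd_iff] at hQ
  refine ⟨Q.coeff 0, hQ, ?_⟩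
  set G := (MvPolynomial.finSuccEquiv K (d + 1)).symm Q with hG
  set e := Polynomial.rootMultiplicity 0 P
  have hFG : F = MvPolynomial.X 0 ^ e * G := by
    apply (MvPolynomial.finSuccEquiv K (d + 1)).injective
    rw [← hP, hPQ]
    simp [hG, MvPolynomial.finSuccEquiv_X_zero]
  have hv : Van S (f ^ e * MvPolynomial.bind₁ (Fin.cons f g : Fin (d + 2) → _) G) := by
    intro s hs
    have := h1 s hs
    rw [hFG] at this
    simpa [eval_bind] using this
  have hv2 := hS.pow e hf hv
  rintro s ⟨hs, hs0⟩
  have := hv2 s hs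
  rw [eval_bind] at this
  have e1 : (fun i => MvPolynomial.eval s ((Fin.cons f g : Fin (d + 2) → _) i))
      = (Fin.cons (0 : K) (fun i => MvPolynomial.eval s (g i)) : Fin (d + 2) → K) := by
    funext i
    refine Fin.cases ?_ (fun i => ?_) i
    · simpa using hs0
    · simp
  rw [e1, MvPolynomial.eval_eq_eval_mv_eval', hG] at this
  simpa [← Polynomial.coeff_zero_eq_eval_zero, Polynomial.coeff_map] using this

/-- the `m`-fold product of an affine set -/
def powSet {σ : Type*} (S : Set (σ → K)) (m : ℕ) : Set (Fin m × σ → K) :=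
  {u | ∀ j, (fun i => u (j, i)) ∈ S}

lemma Irr.powSet {σ : Type*} {S : Set (σ → K)} (h : Irr S) (m : ℕ) : Irr (powSet S m) := by
  classical
  obtain ⟨⟨s0, hs0⟩, h2⟩ := h
  refine ⟨⟨fun p => s0 p.2, fun j => hs0⟩, fun f g hfg => ?_⟩
  by_contra hcon
  push Not at hcon
  obtain ⟨hf, hg⟩ := hcon
  simp only [Van] at hf hg
  push Not at hf hg
  have key : ∀ J : Finset (Fin m), ∃ a ∈ ContactLoci.powSet S m, ∃ b ∈ ContactLoci.powSet S m,
      MvPolynomial.eval a f ≠ 0 ∧ MvPolynomial.eval b g ≠ 0 ∧ ∀ j ∈ J, ∀ i, a (j, i) = b (j, i) := by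
    intro J
    induction J using Finset.induction_on with
    | empty =>
      obtain ⟨a, ha, ha'⟩ := hf
      obtain ⟨b, hb, hb'⟩ := hg
      exact ⟨a, ha, b, hb, ha', hb', by simp⟩
    | insert j J hj ih =>
      obtain ⟨a, ha, b, hb, ha', hb', hab⟩ := ih
      let sub (c : Fin m × σ → K) : Fin m × σ → MvPolynomial σ K := fun p =>
        if p.1 = j then MvPolynomial.X p.2 else MvPolynomial.C (c p)
      let upd (c : Fin m × σ → K) (s : σ → K) : Fin m × σ → K := fun p =>
        if p.1 = j then s p.2 else c p
      have hsub : ∀ c s, (fun p => MvPolynomial.eval s (sub c p)) = upd c s := by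
        intro c s
        funext p
        simp only [sub, upd]
        split_ifs <;> simp
      have hupd : ∀ c, upd c (fun i => c (j, i)) = c := by
        intro c
        funext ⟨p, q⟩
        simp only [upd]
        split_ifs with hh
        · rw [hh]
        · rfl
      have : ¬ Van S (MvPolynomial.bind₁ (sub a) f * MvPolynomial.bind₁ (sub b) g) := by
        intro hv
        rcases h2 _ _ hv with hv | hv
        · have := hv _ (ha j)
          rw [eval_bind, hsub, hupd] at this
          exact ha' this
        · have := hv _ (hb j)
          rw [eval_bind, hsub, hupd] at this
          exact hb' this
      simp only [Van] at this
      push Not at this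
      obtain ⟨s, hs, hs'⟩ := this
      rw [map_mul, eval_bind, eval_bind, hsub, hsub] at hs'
      have hmem : ∀ c ∈ ContactLoci.powSet S m, upd c s ∈ ContactLoci.powSet S m := by
        intro c hc j'
        simp only [upd]
        by_cases hh : j' = j
        · simpa [hh] using hs
        · simpa [hh] using hc j'
      refine ⟨upd a s, hmem a ha, upd b s, hmem b hb, left_ne_zero_of_mul hs',
        right_ne_zero_of_mul hs', ?_⟩
      intro j' hj' i
      simp only [upd]
      split_ifs with hh
      · rfl
      · exact hab j' ((Finset.mem_insert.1 hj').resolve_left hh) i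
  obtain ⟨a, ha, b, hb, ha', hb', hab⟩ := key Finset.univ
  have : a = b := by
    funext p
    exact hab p.1 (Finset.mem_univ _) p.2
  subst this
  have := hfg a ha
  rw [map_mul] at this
  exact mul_ne_zero ha' hb' this

lemma Irr.isPrime {σ : Type*} {S : Set (σ → K)} (h : Irr S) :
    (MvPolynomial.vanishingIdeal K S).IsPrime := by
  rw [Ideal.isPrime_iff]
  refine ⟨?_, fun {f g} hfg => ?_⟩
  · intro h1
    obtain ⟨s, hs⟩ := h.1
    have : (1 : MvPolynomial σ K) ∈ MvPolynomial.vanishingIdeal K S := by rw [h1]; trivial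
    have := this s hs
    simp at this
  · exact h.2 f g hfg

lemma chevalley [IsAlgClosed K] {σ τ : Type*} [Finite σ] [Finite τ] {S : Set (σ → K)}
    (hS : Irr S) (hcl : ContactLoci.acl S ⊆ S) (G : τ → MvPolynomial σ K) :
    ∃ f : MvPolynomial τ K, ¬ Van ((fun s i => MvPolynomial.eval s (G i)) '' S) f ∧
      ∀ v ∈ ContactLoci.acl ((fun s i => MvPolynomial.eval s (G i)) '' S),
        MvPolynomial.eval v f ≠ 0 → v ∈ ((fun s i => MvPolynomial.eval s (G i)) '' S) := by
  set I := MvPolynomial.vanishingIdeal K S with hI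
  have hIp : I.IsPrime := hS.isPrime
  let φ : MvPolynomial τ K →+* MvPolynomial σ K := (MvPolynomial.bind₁ G).toRingHom
  have hft : φ.FinitePresentation := by
    apply RingHom.FinitePresentation.of_finiteType.1
    apply RingHom.FiniteType.of_comp_finiteType (f := MvPolynomial.C)
    have : φ.comp MvPolynomial.C = (MvPolynomial.C : K →+* MvPolynomial σ K) := by
      ext x
      simp [φ]
    rw [this]
    exact RingHom.finiteType_algebraMap.2 (inferInstance : Algebra.FiniteType K (MvPolynomial σ K))
  have hcons : Topology.IsConstructible (PrimeSpectrum.zeroLocus (I : Set (MvPolynomial σ K))) := by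
    rw [← Topology.isConstructible_compl]
    exact (PrimeSpectrum.isRetrocompact_zeroLocus_compl_of_fg
      (IsNoetherian.noetherian I)).isConstructible
        (PrimeSpectrum.isClosed_zeroLocus _).isOpen_compl
  have h1 := PrimeSpectrum.isConstructible_comap_image hft hcons
  obtain ⟨D, hD⟩ := PrimeSpectrum.exists_constructibleSetData_iff.mpr h1
  have hmem : PrimeSpectrum.comap φ ⟨I, hIp⟩ ∈ D.toSet := by
    rw [hD]
    exact ⟨⟨I, hIp⟩, by simp [PrimeSpectrum.mem_zeroLocus], rfl⟩
  rw [PrimeSpectrum.ConstructibleSetData.toSet] at hmem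
  simp only [Set.mem_iUnion] at hmem
  obtain ⟨C, hC, hCmem⟩ := hmem
  have hφ : ∀ s f, MvPolynomial.eval s (φ f) =
    MvPolynomial.eval (fun i => MvPolynomial.eval s (G i)) f := fun s f => eval_bind G f s
  have hmemI : ∀ f, φ f ∈ I ↔ Van ((fun s i => MvPolynomial.eval s (G i)) '' S) f := by
    intro f
    constructor
    · rintro hf _ ⟨s, hs, rfl⟩
      have := hf s hs
      rw [← hφ]
      exact this
    · intro hf s hs
      have := hf _ ⟨s, hs, rfl⟩
      rw [← hφ] at this
      exact this
  refine ⟨C.f, ?_, ?_⟩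
  · intro hv
    apply hCmem.2
    simp only [PrimeSpectrum.mem_zeroLocus, Set.singleton_subset_iff, SetLike.mem_coe]
    exact (hmemI _).2 hv
  · intro v hv hfv
    have hm : (MvPolynomial.pointToPoint (k := K) v) ∈ D.toSet := by
      rw [PrimeSpectrum.ConstructibleSetData.toSet]
      simp only [Set.mem_iUnion]
      refine ⟨C, hC, ?_, ?_⟩
      · rw [PrimeSpectrum.mem_zeroLocus]
        rintro _ ⟨j, rfl⟩
        have := hCmem.1
        rw [PrimeSpectrum.mem_zeroLocus] at this
        have h2 := this ⟨j, rfl⟩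
        have h3 := (hmemI _).1 h2
        show _ ∈ MvPolynomial.vanishingIdeal K {v}
        rw [MvPolynomial.mem_vanishingIdeal_singleton_iff]
        exact hv _ h3
      · intro hh
        simp only [PrimeSpectrum.mem_zeroLocus, Set.singleton_subset_iff] at hh
        have hh' : C.f ∈ MvPolynomial.vanishingIdeal K {v} := hh
        rw [MvPolynomial.mem_vanishingIdeal_singleton_iff] at hh'
        exact hfv hh'
    rw [hD] at hm
    obtain ⟨P, hP, hPv⟩ := hm
    obtain ⟨M, hM, hPM⟩ := Ideal.exists_le_maximal P.asIdeal P.2.ne_top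
    obtain ⟨x, hx⟩ := MvPolynomial.eq_vanishingIdeal_singleton_of_isMaximal K hM
    refine ⟨x, ?_, ?_⟩
    · apply hcl
      intro f hf
      have hfI : f ∈ I := hf
      have : f ∈ M := hPM (hP hfI)
      rw [hx, MvPolynomial.mem_vanishingIdeal_singleton_iff] at this
      exact this
    · funext i
      have : MvPolynomial.X i - MvPolynomial.C (v i) ∈
          (PrimeSpectrum.comap φ P).asIdeal := by
        rw [hPv]
        show _ ∈ MvPolynomial.vanishingIdeal K {v}
        rw [MvPolynomial.mem_vanishingIdeal_singleton_iff]
        simp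
      have h4 : φ (MvPolynomial.X i - MvPolynomial.C (v i)) ∈ M := hPM this
      rw [hx, MvPolynomial.mem_vanishingIdeal_singleton_iff] at h4
      have h5 : MvPolynomial.eval x (φ (MvPolynomial.X i - MvPolynomial.C (v i))) = 0 := h4
      rw [hφ] at h5
      simpa [sub_eq_zero] using h5

set_option linter.unusedSectionVars false


/-- restriction of a polynomial to the line through `v` -/
def lin {ι : Type*} (v : ι → K) : MvPolynomial ι K →ₐ[K] Polynomial K :=
  MvPolynomial.aeval (fun i => Polynomial.C (v i) * Polynomial.X)

lemma eval_lin {ι : Type*} (v : ι → K) (f : MvPolynomial ι K) (t : K) :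
    Polynomial.eval t (lin v f) = MvPolynomial.eval (t • v) f := by
  induction f using MvPolynomial.induction_on with
  | C a => simp [lin]
  | add p q hp hq => simp [hp, hq]
  | mul_X p i hp => simp only [map_mul, Polynomial.eval_mul, hp]; congr 1; simp [lin]; ring

lemma coeff_lin {ι : Type*} (v : ι → K) (f : MvPolynomial ι K) (d : ℕ) :
    (lin v f).coeff d = MvPolynomial.eval v (MvPolynomial.homogeneousComponent d f) := by
  induction f using MvPolynomial.induction_on' with
  | monomial m a =>
    rw [MvPolynomial.homogeneousComponent_of_mem
      ((MvPolynomial.mem_homogeneousSubmodule _ _).2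
        (MvPolynomial.isHomogeneous_monomial a (rfl : m.degree = m.degree)))]
    have : lin v (MvPolynomial.monomial m a) =
        Polynomial.C (MvPolynomial.eval v (MvPolynomial.monomial m a)) *
          Polynomial.X ^ m.degree := by
      simp only [lin, MvPolynomial.aeval_monomial, MvPolynomial.eval_monomial, mul_pow,
        Finsupp.prod_mul, map_mul, Polynomial.algebraMap_eq, Finsupp.degree]
      simp only [Finsupp.prod, map_prod, map_pow, Finset.prod_pow_eq_pow_sum, mul_assoc]
      rfl
    rw [this, Polynomial.coeff_C_mul_X_pow]
    split_ifs <;> simp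
  | add p q hp hq => simp [hp, hq]

lemma mem_sub_iff (x : PP K ι) (v : ι → K) : v ∈ x.submodule ↔ ∃ t : K, t • x.rep = v := by
  rw [Projectivization.submodule_eq, Submodule.mem_span_singleton]

lemma rep_mem (x : PP K ι) : x.rep ∈ x.submodule := (mem_sub_iff x _).2 ⟨1, one_smul _ _⟩

lemma lin_eq_zero [Infinite K] (x : PP K ι) (f : MvPolynomial ι K) :
    (∀ v ∈ x.submodule, MvPolynomial.eval v f = 0) ↔ lin x.rep f = 0 := by
  constructor
  · intro h
    apply Polynomial.funext
    intro t
    rw [eval_lin, Polynomial.eval_zero]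
    exact h _ ((mem_sub_iff x _).2 ⟨t, rfl⟩)
  · intro h v hv
    obtain ⟨t, rfl⟩ := (mem_sub_iff x v).1 hv
    rw [← eval_lin, h, Polynomial.eval_zero]

lemma mem_zeroLocus_iff [Infinite K] (S : Set (MvPolynomial ι K)) (x : PP K ι) :
    x ∈ zeroLocus S ↔ ∀ f ∈ S, lin x.rep f = 0 := by
  simp only [zeroLocus, Set.mem_ofPred_eq, lin_eq_zero]

lemma lin_hc {ι : Type*} (v : ι → K) (f : MvPolynomial ι K) :
    lin v f = 0 ↔ ∀ d, lin v (MvPolynomial.homogeneousComponent d f) = 0 := by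
  constructor
  · intro h d
    ext e
    rw [coeff_lin, Polynomial.coeff_zero]
    by_cases hde : e = d
    · subst hde
      rw [MvPolynomial.homogeneousComponent_eq_self
        (MvPolynomial.homogeneousComponent_isHomogeneous e f), ← coeff_lin, h]
      simp
    · rw [MvPolynomial.homogeneousComponent_of_mem
        (MvPolynomial.homogeneousComponent_mem d f), if_neg hde]
      simp
  · intro h
    ext e
    have := congrArg (fun p => Polynomial.coeff p e) (h e)
    simp only [coeff_lin] at this
    rw [MvPolynomial.homogeneousComponent_eq_self
        (MvPolynomial.homogeneousComponent_isHomogeneous e f)] at this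
    rw [coeff_lin, this, Polynomial.coeff_zero]

lemma isZClosed_zeroLocus [Infinite K] (S : Set (MvPolynomial ι K)) :
    IsZClosed (zeroLocus S) := by
  refine ⟨{g | ∃ f ∈ S, ∃ d, g = MvPolynomial.homogeneousComponent d f}, ?_, ?_⟩
  · rintro _ ⟨f, hf, d, rfl⟩
    exact ⟨d, MvPolynomial.homogeneousComponent_isHomogeneous d f⟩
  · ext x
    simp only [mem_zeroLocus_iff]
    constructor
    · rintro h _ ⟨f, hf, d, rfl⟩
      exact (lin_hc _ _).1 (h f hf) d
    · intro h f hf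
      exact (lin_hc _ _).2 fun d => h _ ⟨f, hf, d, rfl⟩

lemma IsZClosed.union [Infinite K] {Y Z : Set (PP K ι)} (hY : IsZClosed Y) (hZ : IsZClosed Z) :
    IsZClosed (Y ∪ Z) := by
  obtain ⟨S, -, rfl⟩ := hY
  obtain ⟨T, -, rfl⟩ := hZ
  have : zeroLocus S ∪ zeroLocus T = zeroLocus {h | ∃ f ∈ S, ∃ g ∈ T, h = f * g} := by
    ext x
    simp only [Set.mem_union, mem_zeroLocus_iff]
    constructor
    · rintro (h | h) _ ⟨f, hf, g, hg, rfl⟩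
      · rw [map_mul, h f hf, zero_mul]
      · rw [map_mul, h g hg, mul_zero]
    · intro h
      by_contra hcon
      push Not at hcon
      obtain ⟨⟨f, hf, hf'⟩, g, hg, hg'⟩ := hcon
      have := h _ ⟨f, hf, g, hg, rfl⟩
      rw [map_mul] at this
      exact mul_ne_zero hf' hg' this
  rw [this]
  exact isZClosed_zeroLocus _

lemma IsZClosed.inter {Y Z : Set (PP K ι)} (hY : IsZClosed Y) (hZ : IsZClosed Z) :
    IsZClosed (Y ∩ Z) := by
  obtain ⟨S, hS, rfl⟩ := hY
  obtain ⟨T, hT, rfl⟩ := hZ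
  refine ⟨S ∪ T, ?_, ?_⟩
  · rintro f (hf | hf)
    exacts [hS f hf, hT f hf]
  · ext x
    simp only [zeroLocus, Set.mem_inter_iff, Set.mem_ofPred_eq]
    constructor
    · rintro ⟨h1, h2⟩ f (hf | hf)
      exacts [h1 f hf, h2 f hf]
    · intro h
      exact ⟨fun f hf => h f (Or.inl hf), fun f hf => h f (Or.inr hf)⟩

lemma mem_cone {S : Set (PP K ι)} {v : ι → K} : v ∈ coneOf S ↔ ∃ x ∈ S, v ∈ x.submodule := by
  simp [coneOf]

lemma cone_mono {S T : Set (PP K ι)} (h : S ⊆ T) : coneOf S ⊆ coneOf T := by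
  intro v hv
  obtain ⟨x, hx, hv⟩ := mem_cone.1 hv
  exact mem_cone.2 ⟨x, h hx, hv⟩

lemma mem_zeroLocus_iff_cone (S : Set (MvPolynomial ι K)) (Z : Set (PP K ι)) :
    Z ⊆ zeroLocus S ↔ ∀ f ∈ S, Van (coneOf Z) f := by
  constructor
  · intro h f hf v hv
    obtain ⟨x, hx, hv⟩ := mem_cone.1 hv
    exact h hx f hf v hv
  · intro h x hx f hf v hv
    exact h f hf v (mem_cone.2 ⟨x, hx, hv⟩)

lemma zclosure_eq [Infinite K] (S : Set (PP K ι)) :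
    zclosure S = zeroLocus {f | Van (coneOf S) f} := by
  apply Set.Subset.antisymm
  · apply Set.sInter_subset_of_mem
    exact ⟨isZClosed_zeroLocus _, (mem_zeroLocus_iff_cone _ _).2 fun f hf => hf⟩
  · rintro x hx Y ⟨⟨T, -, rfl⟩, hY⟩ f hf
    exact hx f ((mem_zeroLocus_iff_cone _ _).1 hY f hf)

lemma isZClosed_zclosure [Infinite K] (S : Set (PP K ι)) : IsZClosed (zclosure S) := by
  rw [zclosure_eq]; exact isZClosed_zeroLocus _

lemma subset_zclosure (S : Set (PP K ι)) : S ⊆ zclosure S :=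
  Set.subset_sInter fun _ h => h.2

lemma IsZClosed.zclosure_eq {Z : Set (PP K ι)} (h : IsZClosed Z) : zclosure Z = Z :=
  Set.Subset.antisymm (Set.sInter_subset_of_mem ⟨h, subset_rfl⟩) (subset_zclosure Z)

lemma IsZClosed.eq_zeroLocus [Infinite K] {Z : Set (PP K ι)} (h : IsZClosed Z) :
    Z = zeroLocus {f | Van (coneOf Z) f} := by
  rw [← ContactLoci.zclosure_eq, h.zclosure_eq]

lemma exists_van [Infinite K] {Y Z : Set (PP K ι)} (hY : IsZClosed Y) (h : ¬ Z ⊆ Y) :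
    ∃ f, Van (coneOf Y) f ∧ ¬ Van (coneOf Z) f := by
  rw [hY.eq_zeroLocus, mem_zeroLocus_iff_cone] at h
  push Not at h
  exact h

lemma irr_cone [Infinite K] {Z : Set (PP K ι)} (h : IsZIrreducible Z) : Irr (coneOf Z) := by
  obtain ⟨⟨x, hx⟩, h2⟩ := h
  refine ⟨⟨x.rep, mem_cone.2 ⟨x, hx, rep_mem x⟩⟩, fun f g hfg => ?_⟩
  have := h2 (zeroLocus {f}) (zeroLocus {g}) (isZClosed_zeroLocus _) (isZClosed_zeroLocus _) ?_
  · simpa [mem_zeroLocus_iff_cone] using this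
  · intro y hy
    have : y ∈ zeroLocus {f * g} := (mem_zeroLocus_iff_cone {f * g} Z).2 (by simpa using hfg) hy
    rw [mem_zeroLocus_iff] at this
    have := this _ rfl
    rw [map_mul, mul_eq_zero] at this
    simpa [mem_zeroLocus_iff] using this

lemma zero_mem_cone {Z : Set (PP K ι)} (h : Z.Nonempty) : (0 : ι → K) ∈ coneOf Z := by
  obtain ⟨x, hx⟩ := h
  exact mem_cone.2 ⟨x, hx, x.submodule.zero_mem⟩

lemma mk_of_mem_sub {x : PP K ι} {v : ι → K} (hv : v ≠ 0) (h : v ∈ x.submodule) :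
    Projectivization.mk K v hv = x := by
  obtain ⟨t, ht⟩ := (mem_sub_iff x v).1 h
  have := Projectivization.mk_rep x
  rw [← this, Projectivization.mk_eq_mk_iff']
  exact ⟨t, ht⟩

lemma mem_mk_sub {v : ι → K} (hv : v ≠ 0) : v ∈ (Projectivization.mk K v hv).submodule := by
  rw [Projectivization.submodule_mk]
  exact Submodule.mem_span_singleton_self v

lemma mem_cone_iff {Z : Set (PP K ι)} {v : ι → K} (hv : v ≠ 0) :
    v ∈ coneOf Z ↔ Projectivization.mk K v hv ∈ Z := by
  rw [mem_cone]
  constructor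
  · rintro ⟨x, hx, hvx⟩
    rwa [mk_of_mem_sub hv hvx]
  · intro h
    exact ⟨_, h, mem_mk_sub hv⟩

lemma smul_mem_cone {Z : Set (PP K ι)} {v : ι → K} (t : K) (h : v ∈ coneOf Z) :
    t • v ∈ coneOf Z := by
  obtain ⟨x, hx, hv⟩ := mem_cone.1 h
  exact mem_cone.2 ⟨x, hx, x.submodule.smul_mem t hv⟩

lemma acl_cone [Infinite K] {Z : Set (PP K ι)} (h : IsZClosed Z) (hne : Z.Nonempty) :
    ContactLoci.acl (coneOf Z) ⊆ coneOf Z := by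
  intro v hv
  by_cases hv0 : v = 0
  · subst hv0; exact zero_mem_cone hne
  rw [mem_cone_iff hv0, h.eq_zeroLocus]
  intro f hf w hw
  have hf' : ∀ d, Van (coneOf Z) (MvPolynomial.homogeneousComponent d f) := by
    intro d u hu
    have : lin u f = 0 := by
      apply Polynomial.funext
      intro t
      rw [eval_lin, Polynomial.eval_zero]
      exact hf _ (smul_mem_cone t hu)
    rw [← coeff_lin, this, Polynomial.coeff_zero]
  have hl : lin v f = 0 := by
    ext d
    rw [coeff_lin, Polynomial.coeff_zero]
    exact hv _ (hf' d)
  rw [Projectivization.submodule_mk, Submodule.mem_span_singleton] at hw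
  obtain ⟨t, rfl⟩ := hw
  rw [← eval_lin, hl, Polynomial.eval_zero]

lemma van_hc [Infinite K] {Z : Set (PP K ι)} {f : MvPolynomial ι K} (hf : Van (coneOf Z) f)
    (d : ℕ) : Van (coneOf Z) (MvPolynomial.homogeneousComponent d f) := by
  intro u hu
  have : lin u f = 0 := by
    apply Polynomial.funext
    intro t
    rw [eval_lin, Polynomial.eval_zero]
    exact hf _ (smul_mem_cone t hu)
  rw [← coeff_lin, this, Polynomial.coeff_zero]

/-- Components. -/
lemma exists_components [Infinite K] {Z : Set (PP K ι)} (hZ : IsZClosed Z) :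
    ∃ F : Set (Set (PP K ι)), F.Finite ∧ (∀ Y ∈ F, IsZClosed Y ∧ IsZIrreducible Y ∧ Y ⊆ Z) ∧
      Z ⊆ ⋃₀ F := by
  have wf : WellFounded (fun I J : Ideal (MvPolynomial ι K) => I > J) :=
    (inferInstance : WellFoundedGT (Ideal (MvPolynomial ι K))).wf
  have wf2 := InvImage.wf (fun Z : Set (PP K ι) => MvPolynomial.vanishingIdeal K (coneOf Z)) wf
  induction Z using wf2.induction with
  | h Z ih =>
    by_cases hirr : IsZIrreducible Z
    · exact ⟨{Z}, Set.finite_singleton _, by simp [hZ, hirr], by simp⟩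
    by_cases hne : Z.Nonempty
    swap
    · rw [Set.not_nonempty_iff_eq_empty] at hne
      exact ⟨∅, Set.finite_empty, by simp, by simp [hne]⟩
    have : ∃ Y₁ Y₂, IsZClosed Y₁ ∧ IsZClosed Y₂ ∧ Z ⊆ Y₁ ∪ Y₂ ∧ ¬ Z ⊆ Y₁ ∧ ¬ Z ⊆ Y₂ := by
      by_contra hcon
      apply hirr
      refine ⟨hne, fun Y₁ Y₂ h1 h2 h3 => ?_⟩
      by_contra h4
      rw [not_or] at h4
      exact hcon ⟨Y₁, Y₂, h1, h2, h3, h4.1, h4.2⟩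
    obtain ⟨Y₁, Y₂, h1, h2, h12, hn1, hn2⟩ := this
    have aux : ∀ Y, IsZClosed Y → ¬ Z ⊆ Y → MvPolynomial.vanishingIdeal K (coneOf (Z ∩ Y)) >
        MvPolynomial.vanishingIdeal K (coneOf Z) := by
      intro Y hY hn
      refine lt_of_le_of_ne (MvPolynomial.vanishingIdeal_anti_mono (cone_mono Set.inter_subset_left))
        fun heq => ?_
      obtain ⟨f, hf, hf'⟩ := exists_van hY hn
      have : f ∈ MvPolynomial.vanishingIdeal K (coneOf (Z ∩ Y)) := fun v hv =>
        hf v (cone_mono Set.inter_subset_right hv)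
      rw [← heq] at this
      exact hf' this
    obtain ⟨F₁, hF₁, hF₁', hc₁⟩ := ih (Z ∩ Y₁) (aux Y₁ h1 hn1) (hZ.inter h1)
    obtain ⟨F₂, hF₂, hF₂', hc₂⟩ := ih (Z ∩ Y₂) (aux Y₂ h2 hn2) (hZ.inter h2)
    refine ⟨F₁ ∪ F₂, hF₁.union hF₂, ?_, ?_⟩
    · rintro Y (hY | hY)
      · obtain ⟨a, b, c⟩ := hF₁' Y hY
        exact ⟨a, b, c.trans Set.inter_subset_left⟩
      · obtain ⟨a, b, c⟩ := hF₂' Y hY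
        exact ⟨a, b, c.trans Set.inter_subset_left⟩
    · intro x hx
      rw [Set.sUnion_union]
      rcases h12 hx with h | h
      · exact Or.inl (hc₁ ⟨hx, h⟩)
      · exact Or.inr (hc₂ ⟨hx, h⟩)

lemma irr_sUnion [Infinite K] {T : Set (PP K ι)} (hT : IsZIrreducible T)
    {F : Set (Set (PP K ι))} (hF : F.Finite) (hcl : ∀ Y ∈ F, IsZClosed Y) (h : T ⊆ ⋃₀ F) :
    ∃ Y ∈ F, T ⊆ Y := by
  have hcl' : ∀ F : Set (Set (PP K ι)), F.Finite → (∀ Y ∈ F, IsZClosed Y) →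
      IsZClosed (⋃₀ F) := by
    intro F hF
    induction F, hF using Set.Finite.induction_on with
    | empty =>
      intro _
      refine ⟨{1}, by simpa using ⟨0, MvPolynomial.isHomogeneous_one ι K⟩, ?_⟩
      ext x
      simp [zeroLocus]
      exact ⟨0, x.submodule.zero_mem⟩
    | insert _ _ ih =>
      intro h
      rw [Set.sUnion_insert]
      exact (h _ (Set.mem_insert _ _)).union (ih fun Y hY => h Y (Set.mem_insert_of_mem _ hY))
  induction F, hF using Set.Finite.induction_on with
  | empty =>
    obtain ⟨x, hx⟩ := hT.1
    simpa using h hx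
  | insert _ hfin ih =>
    rw [Set.sUnion_insert] at h
    rcases hT.2 _ _ (hcl _ (Set.mem_insert _ _))
      (hcl' _ hfin fun Y hY => hcl Y (Set.mem_insert_of_mem _ hY)) h with h1 | h1
    · exact ⟨_, Set.mem_insert _ _, h1⟩
    · obtain ⟨Y, hY, h2⟩ := ih (fun Y hY => hcl Y (Set.mem_insert_of_mem _ hY)) h1
      exact ⟨Y, Set.mem_insert_of_mem _ hY, h2⟩

set_option linter.unusedSectionVars false


lemma not_DLE_zero [Infinite K] {Z : Set (PP K ι)} (hne : Z.Nonempty) : ¬ DLE (coneOf Z) 0 := by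
  intro h
  obtain ⟨x, hx⟩ := hne
  obtain ⟨i, hi⟩ := Function.ne_iff.1 x.rep_nonzero
  obtain ⟨F, hF, hF'⟩ := h fun _ => MvPolynomial.X i
  apply hF
  apply MvPolynomial.funext
  intro r
  have hi' : x.rep i ≠ 0 := hi
  have := hF' ((r 0 / x.rep i) • x.rep) (mem_cone.2 ⟨x, hx, (mem_sub_iff _ _).2 ⟨_, rfl⟩⟩)
  rw [map_zero, ← this]
  congr 1
  congr 1
  funext j
  have : j = 0 := Fin.ext (by omega)
  subst this
  simp [hi']

lemma DLE_lt [Infinite K] {Y Z : Set (PP K ι)} {d : ℕ} (hY : IsZClosed Y)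
    (hZ : IsZIrreducible Z) (h : Y < Z) (hd : DLE (coneOf Z) (d + 1)) : DLE (coneOf Y) d := by
  obtain ⟨f, hf, hf'⟩ := exists_van hY (not_le_of_gt h)
  refine (DLE.cut (irr_cone hZ) hd f hf').mono fun v hv => ⟨cone_mono h.le hv, hf v hv⟩

lemma height_le [Infinite K] {C : Set (PP K ι)} (d : ℕ) :
    ∀ (Y : {Y : Set (PP K ι) // IsZClosed Y ∧ IsZIrreducible Y ∧ Y ⊆ C}),
      DLE (coneOf Y.1) (d + 1) → Order.height Y ≤ d := by
  induction d with
  | zero =>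
    intro Y hY
    rw [Order.height_le_coe_iff]
    intro y hy
    exact absurd (DLE_lt y.2.1 Y.2.2.1 hy hY) (not_DLE_zero y.2.2.1.1)
  | succ d ih =>
    intro Y hY
    rw [Order.height_le_coe_iff]
    intro y hy
    refine (ih y (DLE_lt y.2.1 Y.2.2.1 hy hY)).trans_lt ?_
    exact_mod_cast Nat.lt_succ_self d

lemma zdim_le [Infinite K] {S : Set (PP K ι)} {d : ℕ} (h : DLE (coneOf (zclosure S)) (d + 1)) :
    zdim S ≤ ((d : ℕ∞) : WithBot ℕ∞) := by
  rw [zdim, Order.krullDim_eq_iSup_height]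
  apply iSup_le
  intro Y
  exact_mod_cast height_le d Y (h.mono (cone_mono Y.2.2.2))

/-- the polynomial of a linear form -/
def lpoly (l : Module.Dual K (ι → K)) : MvPolynomial ι K := by
  classical
  exact ∑ i, MvPolynomial.C (l (Pi.single i 1)) * MvPolynomial.X i

lemma eval_lpoly (l : Module.Dual K (ι → K)) (v : ι → K) :
    MvPolynomial.eval v (lpoly l) = l v := by
  classical
  simp only [lpoly, map_sum, map_mul, MvPolynomial.eval_C, MvPolynomial.eval_X]
  conv_rhs => rw [← Finset.univ_sum_single v]
  rw [map_sum]
  refine Finset.sum_congr rfl fun i _ => ?_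
  have : (Pi.single i (v i) : ι → K) = v i • Pi.single i 1 := by
    rw [← Pi.single_smul, smul_eq_mul, mul_one]
  rw [this, map_smul, smul_eq_mul, mul_comm]

lemma lpoly_homog (l : Module.Dual K (ι → K)) : (lpoly l).IsHomogeneous 1 := by
  classical
  unfold lpoly
  apply MvPolynomial.IsHomogeneous.sum
  intro i _
  exact MvPolynomial.IsHomogeneous.C_mul (MvPolynomial.isHomogeneous_X _ _) _

lemma exists_linear_forms [Infinite K] (m : ℕ) : ∀ {Z : Set (PP K ι)}, IsZClosed Z →
    zdim Z < ((m : ℕ∞) : WithBot ℕ∞) → ∃ l : Fin m → Module.Dual K (ι → K),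
      ∀ v ∈ coneOf Z, (∀ j, l j v = 0) → v = 0 := by
  induction m with
  | zero =>
    intro Z hZ hd
    refine ⟨Fin.elim0, fun v hv _ => ?_⟩
    exfalso
    obtain ⟨x, hx, -⟩ := mem_cone.1 hv
    obtain ⟨F, -, hF, hc⟩ := exists_components hZ
    obtain ⟨Y, hY, -⟩ := hc hx
    have : Nonempty {Y : Set (PP K ι) // IsZClosed Y ∧ IsZIrreducible Y ∧ Y ⊆ zclosure Z} :=
      ⟨⟨Y, (hF Y hY).1, (hF Y hY).2.1, (hF Y hY).2.2.trans (subset_zclosure Z)⟩⟩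
    have := Order.krullDim_nonneg
      (α := {Y : Set (PP K ι) // IsZClosed Y ∧ IsZIrreducible Y ∧ Y ⊆ zclosure Z})
    exact absurd hd (not_lt.2 (by simpa [zdim] using this))
  | succ m ih =>
    intro Z hZ hd
    obtain ⟨F, hFfin, hF, hc⟩ := exists_components hZ
    have : Finite F := hFfin
    choose p hp using fun Y : F => (hF Y.1 Y.2).2.1.1
    obtain ⟨l0, hl0⟩ := Module.exists_dual_forall_apply_ne_zero (K := K)
      (fun Y : F => (p Y).rep) (fun Y => (p Y).rep_nonzero)
    set Z' := Z ∩ zeroLocus {lpoly l0} with hZ'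
    have hZ'c : IsZClosed Z' := hZ.inter (isZClosed_zeroLocus _)
    have hd' : zdim Z' < ((m : ℕ∞) : WithBot ℕ∞) := by
      by_contra hcon
      rw [not_lt] at hcon
      have hcon' : (m : WithBot ℕ∞) ≤ Order.krullDim
        {Y : Set (PP K ι) // IsZClosed Y ∧ IsZIrreducible Y ∧ Y ⊆ zclosure Z'} := hcon
      rw [Order.le_krullDim_iff] at hcon'
      obtain ⟨s, hs⟩ := hcon'
      have hT : IsZClosed s.last.1 ∧ IsZIrreducible s.last.1 ∧ s.last.1 ⊆ Z' :=
        ⟨s.last.2.1, s.last.2.2.1, s.last.2.2.2.trans hZ'c.zclosure_eq.subset⟩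
      obtain ⟨Y, hY, hTY⟩ := irr_sUnion hT.2.1 hFfin (fun Y hY => (hF Y hY).1)
        ((hT.2.2.trans Set.inter_subset_left).trans hc)
      have hne : s.last.1 ≠ Y := by
        intro heq
        have h1 : p ⟨Y, hY⟩ ∈ s.last.1 := by rw [heq]; exact hp ⟨Y, hY⟩
        have h2 := (hT.2.2 h1).2 _ rfl _ (rep_mem _)
        rw [eval_lpoly] at h2
        exact hl0 _ h2
      have hsub : zclosure Z' ⊆ zclosure Z := by
        rw [hZ'c.zclosure_eq]
        exact Set.inter_subset_left.trans (subset_zclosure Z)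
      let φ : {Y : Set (PP K ι) // IsZClosed Y ∧ IsZIrreducible Y ∧ Y ⊆ zclosure Z'} →
        {Y : Set (PP K ι) // IsZClosed Y ∧ IsZIrreducible Y ∧ Y ⊆ zclosure Z} :=
        fun Y => ⟨Y.1, Y.2.1, Y.2.2.1, Y.2.2.2.trans hsub⟩
      have hφ : StrictMono φ := fun a b h => h
      let Yt : {Y : Set (PP K ι) // IsZClosed Y ∧ IsZIrreducible Y ∧ Y ⊆ zclosure Z} :=
        ⟨Y, (hF Y hY).1, (hF Y hY).2.1, (hF Y hY).2.2.trans (subset_zclosure Z)⟩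
      have hlt : (s.map φ hφ).last < Yt := by
        rw [LTSeries.last_map]
        exact lt_of_le_of_ne hTY (fun h => hne (congrArg Subtype.val h))
      have : ((m + 1 : ℕ) : WithBot ℕ∞) ≤ zdim Z := by
        rw [zdim, Order.le_krullDim_iff]
        exact ⟨(s.map φ hφ).snoc Yt hlt, by simp [hs]⟩
      exact absurd hd (not_lt.2 this)
    obtain ⟨l, hl⟩ := ih hZ'c hd'
    refine ⟨Fin.cons l0 l, fun v hv h => ?_⟩
    by_cases hv0 : v = 0
    · exact hv0
    apply hl v
    · rw [mem_cone_iff hv0]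
      rw [mem_cone_iff hv0] at hv
      refine ⟨hv, ?_⟩
      rintro _ rfl w hw
      rw [Projectivization.submodule_mk, Submodule.mem_span_singleton] at hw
      obtain ⟨t, rfl⟩ := hw
      have h0 := h 0
      rw [Fin.cons_zero] at h0
      rw [eval_lpoly, map_smul, h0, smul_zero]
    · intro j
      have := h j.succ
      simpa using this

set_option linter.unusedSectionVars false


lemma graded_nak {A : Type*} [CommRing A] [IsDomain A] [Algebra K A] {p : ℕ}
    (ρ : MvPolynomial ι K →ₐ[K] A) (L : Fin p → MvPolynomial ι K) (B : Subalgebra K A)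
    (hL : ∀ c, ρ (L c) ∈ B) (N : ι → ℕ) (hN : ∀ i, 1 ≤ N i)
    (g : ι → Fin p → MvPolynomial ι K) (hg : ∀ i c, (g i c).IsHomogeneous (N i - 1))
    (h : ∀ i, ρ (MvPolynomial.X i ^ N i) = ∑ c, ρ (L c) * ρ (g i c)) (i : ι) :
    IsIntegral B (ρ (MvPolynomial.X i)) := by
  classical
  set D := ∑ i, N i + 1 with hD
  set T : Set (ι →₀ ℕ) := {a | a.degree < D} with hT
  have hTf : T.Finite := (Finsupp.finite_of_degree_le (σ := ι) D).subset fun a (ha : a.degree < D) => ha.le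
  set M : Submodule B A := Submodule.span B ((fun a => ρ (MvPolynomial.monomial a 1)) '' T) with hM
  have hK : ∀ (c : K) (x : A), x ∈ M → c • x ∈ M := by
    intro c x hx
    have : c • x = (algebraMap K B c) • x := by
      rw [algebraMap_smul]
    rw [this]
    exact M.smul_mem _ hx
  have key : ∀ d, ∀ f : MvPolynomial ι K, f.IsHomogeneous d → ρ f ∈ M := by
    intro d
    induction d using Nat.strong_induction_on with
    | _ d ih =>
      have hmono : ∀ a : ι →₀ ℕ, a.degree = d → ρ (MvPolynomial.monomial a 1) ∈ M := by
        intro a ha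
        by_cases hd : d < D
        · exact Submodule.subset_span ⟨a, show a.degree < D by omega, rfl⟩
        · have : ∃ j, N j ≤ a j := by
            by_contra hcon
            push Not at hcon
            have h1 : a.degree ≤ ∑ j, N j := by
              rw [Finsupp.degree_eq_sum]
              exact Finset.sum_le_sum fun j _ => (hcon j).le
            omega
          obtain ⟨j, hj⟩ := this
          have hsplit : Finsupp.single j (N j) + (a - Finsupp.single j (N j)) = a := by
            apply add_tsub_cancel_of_le
            rw [Finsupp.single_le_iff]
            exact hj
          have hdeg : (a - Finsupp.single j (N j)).degree + N j = d := by
            rw [← ha]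
            conv_rhs => rw [← hsplit]
            rw [map_add, Finsupp.degree_single, add_comm]
          have : MvPolynomial.monomial a (1 : K) =
              MvPolynomial.X j ^ N j * MvPolynomial.monomial (a - Finsupp.single j (N j)) 1 := by
            rw [MvPolynomial.X_pow_eq_monomial, MvPolynomial.monomial_mul, hsplit, one_mul]
          rw [this, map_mul, h, Finset.sum_mul]
          refine M.sum_mem fun c _ => ?_
          have h2 : ρ (g j c * MvPolynomial.monomial (a - Finsupp.single j (N j)) 1) ∈ M := by
            apply ih (d - 1) (by have := hN j; omega)
            have := (hg j c).mul (MvPolynomial.isHomogeneous_monomial (R := K) 1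
              (rfl : (a - Finsupp.single j (N j)).degree = _))
            convert this using 1
            have := hN j
            omega
          have h3 := M.smul_mem ⟨_, hL c⟩ h2
          rw [Subalgebra.smul_def, smul_eq_mul, map_mul, ← mul_assoc] at h3
          exact h3
      intro f hf
      rw [f.as_sum, map_sum]
      refine M.sum_mem fun a ha => ?_
      have : MvPolynomial.monomial a (MvPolynomial.coeff a f) =
          MvPolynomial.coeff a f • MvPolynomial.monomial a (1 : K) := by
        rw [MvPolynomial.smul_monomial, smul_eq_mul, mul_one]
      rw [this, map_smul]
      apply hK
      apply hmono
      have := hf (MvPolynomial.mem_support_iff.1 ha)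
      rw [← this, Finsupp.degree_eq_weight_one]
      rfl
  apply isIntegral_of_smul_mem_submodule M
  · intro hbot
    have h1 := key 0 1 (MvPolynomial.isHomogeneous_one _ _)
    rw [hbot, map_one, Submodule.mem_bot] at h1
    exact one_ne_zero h1
  · exact Submodule.fg_span (hTf.image _)
  · intro x hx
    induction hx using Submodule.span_induction with
    | mem x hx =>
      obtain ⟨a, -, rfl⟩ := hx
      rw [smul_eq_mul]
      simp only
      rw [← map_mul]
      exact key _ _ ((MvPolynomial.isHomogeneous_X K i).mul
        (MvPolynomial.isHomogeneous_monomial (R := K) 1 rfl))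
    | zero => simp
    | add x y _ _ hx hy => rw [smul_add]; exact M.add_mem hx hy
    | smul c x _ hx =>
      rw [smul_comm]; exact M.smul_mem _ hx

lemma noether_rel [IsAlgClosed K] {X : Set (PP K ι)} (hX : IsZClosed X) (hne : X.Nonempty)
    {p : ℕ} (l : Fin p → Module.Dual K (ι → K))
    (hl : ∀ v ∈ coneOf X, (∀ j, l j v = 0) → v = 0) (i : ι) :
    ∃ N : ℕ, 1 ≤ N ∧ ∃ g : Fin p → MvPolynomial ι K, (∀ c, (g c).IsHomogeneous (N - 1)) ∧
      Van (coneOf X) (MvPolynomial.X i ^ N - ∑ c, lpoly (l c) * g c) := by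
  have : Infinite K := IsAlgClosed.instInfinite
  set I := MvPolynomial.vanishingIdeal K (coneOf X) with hI
  set J := Ideal.span (Set.range fun c => lpoly (l c)) with hJ
  have h1 : MvPolynomial.X i ∈ (I ⊔ J).radical := by
    rw [← MvPolynomial.vanishingIdeal_zeroLocus_eq_radical (K := K), MvPolynomial.mem_vanishingIdeal_iff]
    intro v hv
    rw [MvPolynomial.mem_zeroLocus_iff] at hv
    have hv1 : v ∈ coneOf X := by
      apply acl_cone hX hne
      intro f hf
      exact hv f (Ideal.mem_sup_left (MvPolynomial.mem_vanishingIdeal_iff.2 hf))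
    have hv2 : v = 0 := by
      apply hl v hv1
      intro j
      rw [← eval_lpoly]
      exact hv _ (Ideal.mem_sup_right (Ideal.subset_span ⟨j, rfl⟩))
    simp [hv2]
  obtain ⟨N, hN⟩ := h1
  have hN1 : MvPolynomial.X i ^ (N + 1) ∈ I ⊔ J := by
    rw [pow_succ]; exact Ideal.mul_mem_right _ _ hN
  obtain ⟨f, hf, q, hq, hfq⟩ := Submodule.mem_sup.1 hN1
  rw [hJ, Ideal.mem_span_range_iff_exists_fun] at hq
  obtain ⟨c, hc⟩ := hq
  refine ⟨N + 1, by omega, fun j => MvPolynomial.homogeneousComponent N (c j), ?_, ?_⟩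
  · intro j
    exact MvPolynomial.homogeneousComponent_isHomogeneous _ _
  · have hfv : Van (coneOf X) f := MvPolynomial.mem_vanishingIdeal_iff.1 hf
    have := van_hc hfv (N + 1)
    convert this using 1
    have h2 := congrArg (MvPolynomial.homogeneousComponent (N + 1)) hfq
    rw [map_add, MvPolynomial.homogeneousComponent_of_mem
      (MvPolynomial.isHomogeneous_X_pow (R := K) i (N + 1)), if_pos rfl, ← hc, map_sum] at h2
    rw [← h2, add_sub_assoc, add_eq_left, sub_eq_zero]
    refine Finset.sum_congr rfl fun j _ => ?_
    let _ := MvPolynomial.gradedAlgebra (σ := ι) (R := K)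
    have := DirectSum.coe_decompose_mul_add_of_left_mem
      (MvPolynomial.homogeneousSubmodule ι K) (i := 1) (j := N) (b := c j) (lpoly_homog (l j))
    rw [add_comm 1 N] at this
    have h5 := MvPolynomial.decomposition.decompose'_apply (R := K) (lpoly (l j) * c j) (N + 1)
    have h6 := MvPolynomial.decomposition.decompose'_apply (R := K) (c j) N
    beta_reduce
    rw [mul_comm, ← h5, ← h6]
    exact this

lemma dle_pow [IsAlgClosed K] {X : Set (PP K ι)} (hX : IsIntegralVariety X) {n : ℕ}
    (hd : zdim X = ((n : ℕ∞) : WithBot ℕ∞)) (m : ℕ) :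
    DLE (powSet (coneOf X) m) (m * (n + 1)) := by
  have : Infinite K := IsAlgClosed.instInfinite
  obtain ⟨l, hl⟩ := exists_linear_forms (n + 1) hX.1 (by
    rw [hd]; exact_mod_cast Nat.lt_succ_self n)
  choose N hN g hg hv using noether_rel hX.1 hX.2.1 l hl
  have hirr : Irr (powSet (coneOf X) m) := (irr_cone hX.2).powSet m
  set I := MvPolynomial.vanishingIdeal K (powSet (coneOf X) m) with hI
  have hp : I.IsPrime := hirr.isPrime
  let A := MvPolynomial (Fin m × ι) K ⧸ I
  let ρ : Fin m → (MvPolynomial ι K →ₐ[K] A) := fun j =>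
    (Ideal.Quotient.mkₐ K I).comp (MvPolynomial.rename fun i => (j, i))
  have hρ : ∀ j f, Van (coneOf X) f → ρ j f = 0 := by
    intro j f hf
    apply Ideal.Quotient.eq_zero_iff_mem.2
    rw [hI, MvPolynomial.mem_vanishingIdeal_iff]
    intro u hu
    have := hf _ (hu j)
    change MvPolynomial.eval u (MvPolynomial.rename _ f) = 0
    rw [MvPolynomial.eval_rename]
    exact this
  set s : Set A := Set.range fun q : Fin m × Fin (n + 1) => ρ q.1 (lpoly (l q.2)) with hs
  have hint : ∀ x : A, IsIntegral (Algebra.adjoin K s) x := by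
    intro x
    obtain ⟨f, rfl⟩ := Ideal.Quotient.mk_surjective x
    induction f using MvPolynomial.induction_on with
    | C a =>
      exact isIntegral_algebraMap (R := Algebra.adjoin K s) (x := algebraMap K _ a)
    | add p q hp hq => rw [map_add]; exact hp.add hq
    | mul_X p q hp =>
      rw [map_mul]
      refine hp.mul ?_
      have := graded_nak (ρ q.1) (fun c => lpoly (l c)) (Algebra.adjoin K s)
        (fun c => Algebra.subset_adjoin ⟨(q.1, c), rfl⟩) N hN g hg (fun i => by
          have := hρ q.1 _ (hv i)
          rw [map_sub, sub_eq_zero] at this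
          rw [this, map_sum]
          simp only [map_mul]) q.2
      convert this using 1
      change _ = Ideal.Quotient.mk I (MvPolynomial.rename _ (MvPolynomial.X q.2))
      rw [MvPolynomial.rename_X]
  have halg : Algebra.IsAlgebraic (Algebra.adjoin K s) A := ⟨fun x => (hint x).isAlgebraic⟩
  have htr := Algebra.IsAlgebraic.trdeg_le_cardinalMk K s
  intro G
  by_contra hcon
  push Not at hcon
  have hind : AlgebraicIndependent K (fun i => Ideal.Quotient.mkₐ K I (G i)) := by
    rw [algebraicIndependent_iff]
    intro F hF
    by_contra hF0
    obtain ⟨u, hu, hne⟩ := hcon F hF0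
    apply hne
    rw [← eval_bind]
    have : Ideal.Quotient.mkₐ K I (MvPolynomial.bind₁ G F) = 0 := by
      rw [← hF]
      rw [MvPolynomial.bind₁, ← AlgHom.comp_apply, MvPolynomial.comp_aeval]
    have := Ideal.Quotient.eq_zero_iff_mem.1 this
    exact MvPolynomial.mem_vanishingIdeal_iff.1 this u hu
  have h1 := hind.lift_cardinalMk_le_trdeg
  have h2 : Cardinal.mk s ≤ (m * (n + 1) : ℕ) := by
    have := Cardinal.mk_range_le_lift (f := fun q : Fin m × Fin (n + 1) => ρ q.1 (lpoly (l q.2)))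
    simpa using this
  have h3 := h1.trans (Cardinal.lift_le.2 (htr.trans h2))
  simp only [Cardinal.mk_fin, Cardinal.lift_natCast] at h3
  have h4 : m * (n + 1) + 1 ≤ m * (n + 1) := by exact_mod_cast h3
  omega

set_option linter.unusedSectionVars false


lemma mem_vspan_finset (A : Finset (PP K ι)) (v : ι → K) (h : v ∈ vspan (A : Set (PP K ι))) :
    ∃ w : PP K ι → ι → K, (∀ x, w x ∈ x.submodule) ∧ ∑ x ∈ A, w x = v := by
  classical
  unfold vspan at h
  induction h using Submodule.span_induction with
  | mem v hv =>
    obtain ⟨x, hx, hvx⟩ := mem_cone.1 hv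
    refine ⟨fun y => if y = x then v else 0, fun y => ?_, ?_⟩
    · dsimp only
      split_ifs with h
      · rw [h]; exact hvx
      · exact y.submodule.zero_mem
    · rw [Finset.sum_ite_eq' A x (fun _ => v), if_pos (by exact_mod_cast hx)]
  | zero => exact ⟨fun _ => 0, fun x => x.submodule.zero_mem, by simp⟩
  | add v v' _ _ h h' =>
    obtain ⟨w, hw, rfl⟩ := h
    obtain ⟨w', hw', rfl⟩ := h'
    exact ⟨fun x => w x + w' x, fun x => x.submodule.add_mem (hw x) (hw' x),
      Finset.sum_add_distrib⟩
  | smul c v _ h =>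
    obtain ⟨w, hw, rfl⟩ := h
    exact ⟨fun x => c • w x, fun x => x.submodule.smul_mem _ (hw x), by rw [Finset.smul_sum]⟩

lemma sum_mem_vspan (A : Finset (PP K ι)) (w : PP K ι → ι → K) (hw : ∀ x, w x ∈ x.submodule) :
    ∑ x ∈ A, w x ∈ vspan (A : Set (PP K ι)) :=
  Submodule.sum_mem _ fun x hx => Submodule.subset_span (mem_cone.2 ⟨x, by exact_mod_cast hx, hw x⟩)

lemma mem_projSpan {q : PP K ι} {S : Set (PP K ι)} {v : ι → K} (hv : v ∈ q.submodule)
    (hv0 : v ≠ 0) (h : v ∈ vspan S) : q ∈ projSpan S := by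
  intro w hw
  rw [← mk_of_mem_sub hv0 hv, Projectivization.submodule_mk, Submodule.mem_span_singleton] at hw
  obtain ⟨t, rfl⟩ := hw
  exact Submodule.smul_mem _ _ h

lemma xrank_le {X : Set (PP K ι)} {q : PP K ι} {S : Finset (PP K ι)} (hS : (S : Set (PP K ι)) ⊆ X)
    (h : q ∈ projSpan (S : Set (PP K ι))) : xrank X q ≤ S.card :=
  Nat.sInf_le ⟨S, hS, rfl, h⟩

lemma xrank_le_of_sum {X : Set (PP K ι)} {q : PP K ι} {m : ℕ} (u : Fin m → ι → K)
    (hu : ∀ j, u j ∈ coneOf X) {v : ι → K} (hv : v ∈ q.submodule) (hv0 : v ≠ 0)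
    (hs : ∑ j, u j = v) : xrank X q ≤ m := by
  classical
  choose x hx hux using fun j => mem_cone.1 (hu j)
  have h1 : xrank X q ≤ (Finset.univ.image x).card := by
    apply xrank_le
    · intro y hy
      simp only [Finset.coe_image, Finset.coe_univ, Set.image_univ] at hy
      obtain ⟨j, rfl⟩ := hy
      exact hx j
    · apply mem_projSpan hv hv0
      rw [← hs]
      refine Submodule.sum_mem _ fun j _ => Submodule.subset_span (mem_cone.2 ⟨x j, ?_, hux j⟩)
      simp
  exact h1.trans (Finset.card_image_le.trans (by simp))

lemma exists_sum {X : Set (PP K ι)} (hne : X.Nonempty) (w : PP K ι → ι → K)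
    (hw : ∀ x, w x ∈ x.submodule) (S : Finset (PP K ι)) :
    ∀ m, S.card ≤ m → (S : Set (PP K ι)) ⊆ X →
      ∃ u : Fin m → ι → K, (∀ j, u j ∈ coneOf X) ∧ ∑ j, u j = ∑ x ∈ S, w x := by
  classical
  induction S using Finset.induction_on with
  | empty =>
    intro m _ _
    exact ⟨fun _ => 0, fun _ => zero_mem_cone hne, by simp⟩
  | insert a S ha ih =>
    intro m hm hS
    rw [Finset.card_insert_of_notMem ha] at hm
    rw [Finset.coe_insert, Set.insert_subset_iff] at hS
    obtain ⟨m, rfl⟩ : ∃ m', m = m' + 1 := ⟨m - 1, by omega⟩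
    obtain ⟨u, hu, hus⟩ := ih m (by omega) hS.2
    refine ⟨Fin.cons (w a) u, ?_, ?_⟩
    · intro j
      refine Fin.cases ?_ (fun j => ?_) j
      · exact mem_cone.2 ⟨a, hS.1, hw a⟩
      · exact hu j
    · rw [Fin.sum_cons, hus, Finset.sum_insert ha]

lemma pointwise {X : Set (PP K ι)} (hne : X.Nonempty) {k α : ℕ} (hk : 1 ≤ k) {q : PP K ι}
    (hrank : xrank X q ≤ k + 1) {v : ι → K} (hv : v ∈ q.submodule) (hv0 : v ≠ 0)
    {Y : Set (PP K ι)} {fY : MvPolynomial ι K} (hfY : Van (coneOf Y) fY) (i0 : ι)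
    (hB : ∀ u : Fin (k + 1) → ι → K, (∀ j, u j ∈ coneOf X) → ∑ j, u j = v →
      u 0 i0 ≠ 0 ∧ MvPolynomial.eval (∑ j : Fin k, u j.succ) fY ≠ 0)
    (hY : ∀ x ∈ secant k X \ Y, (decompositions X x).ncard = α) (hα : 1 < α) :
    ∀ A ∈ decompositions X q, ∀ a ∈ A,
        ∃ B : Finset (Finset (PP K ι)), B.card = α ∧ A ∈ B ∧
          ∀ S ∈ B, S ∈ decompositions X q ∧ a ∈ S := by
  classical
  have hlow : ∀ S : Finset (PP K ι), (S : Set (PP K ι)) ⊆ X → q ∈ projSpan (S : Set (PP K ι)) →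
      k + 1 ≤ S.card := by
    intro S hS hq
    by_contra hcon
    obtain ⟨w, hw, hws⟩ := mem_vspan_finset S v (hq hv)
    obtain ⟨u, hu, hus⟩ := exists_sum hne w hw S k (by omega) hS
    have := (hB (Fin.cons 0 u) ?_ ?_).1
    · exact this rfl
    · intro j
      refine Fin.cases ?_ (fun j => ?_) j
      · exact zero_mem_cone hne
      · exact hu j
    · rw [Fin.sum_cons, hus, hws, zero_add]
  intro A hA a ha
  obtain ⟨hAX, hAc, hAq⟩ := hA
  have hAge := hlow A hAX hAq
  have hAcard : A.card = k + 1 := by omega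
  have hq : xrank X q = k + 1 := by omega
  obtain ⟨w, hw, hws⟩ := mem_vspan_finset A v (hAq hv)
  have haX : a ∈ X := hAX (by exact_mod_cast ha)
  have hEX : ((A.erase a : Finset (PP K ι)) : Set (PP K ι)) ⊆ X := fun x hx =>
    hAX (by exact_mod_cast Finset.mem_of_mem_erase (by exact_mod_cast hx))
  have hEc : (A.erase a).card = k := by rw [Finset.card_erase_of_mem ha]; omega
  set v' := ∑ x ∈ A.erase a, w x with hv'
  have hvv : w a + v' = v := by rw [← hws, hv', Finset.add_sum_erase A w ha]
  have hfv' : MvPolynomial.eval v' fY ≠ 0 := by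
    obtain ⟨u, hu, hus⟩ := exists_sum hne w hw (A.erase a) k hEc.le hEX
    have := (hB (Fin.cons (w a) u) ?_ ?_).2
    · simpa [hus] using this
    · intro j
      refine Fin.cases ?_ (fun j => ?_) j
      · exact mem_cone.2 ⟨a, haX, hw a⟩
      · exact hu j
    · rw [Fin.sum_cons, hus, hvv]
  have hv'0 : v' ≠ 0 := by
    intro h0
    have : q ∈ projSpan (({a} : Finset (PP K ι)) : Set (PP K ι)) := by
      apply mem_projSpan hv hv0
      rw [← hvv, h0, add_zero]
      exact Submodule.subset_span (mem_cone.2 ⟨a, by simp, hw a⟩)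
    have := hlow {a} (by simpa using haX) this
    rw [Finset.card_singleton] at this
    omega
  set q' := Projectivization.mk K v' hv'0 with hq'
  have hmq' : v' ∈ q'.submodule := mem_mk_sub hv'0
  have hq'Y : q' ∉ Y := fun h => hfv' (hfY v' (mem_cone.2 ⟨q', h, hmq'⟩))
  have hq'E : q' ∈ projSpan ((A.erase a : Finset (PP K ι)) : Set (PP K ι)) :=
    mem_projSpan hmq' hv'0 (sum_mem_vspan _ w hw)
  have hq's : q' ∈ secant k X := subset_zclosure _ ⟨A.erase a, hEX, hEc, hq'E⟩
  have hcard := hY q' ⟨hq's, hq'Y⟩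
  have hfin : (decompositions X q').Finite := Set.finite_of_ncard_pos (by omega)
  have hins : ∀ S : Finset (PP K ι), (S : Set (PP K ι)) ⊆ X → q' ∈ projSpan (S : Set (PP K ι)) →
      q ∈ projSpan ((insert a S : Finset (PP K ι)) : Set (PP K ι)) := by
    intro S hS hqS
    apply mem_projSpan hv hv0
    rw [← hvv]
    apply Submodule.add_mem
    · exact Submodule.subset_span (mem_cone.2 ⟨a, by simp, hw a⟩)
    · exact Submodule.span_mono (cone_mono (by simp)) (hqS hmq')
  have hinsX : ∀ S : Finset (PP K ι), (S : Set (PP K ι)) ⊆ X →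
      ((insert a S : Finset (PP K ι)) : Set (PP K ι)) ⊆ X := by
    intro S hS
    rw [Finset.coe_insert, Set.insert_subset_iff]
    exact ⟨haX, hS⟩
  have hlow' : ∀ S : Finset (PP K ι), (S : Set (PP K ι)) ⊆ X → q' ∈ projSpan (S : Set (PP K ι)) →
      k ≤ S.card := by
    intro S hS hqS
    have h1 := hlow _ (hinsX S hS) (hins S hS hqS)
    have h2 := Finset.card_insert_le a S
    omega
  have hq'r : xrank X q' = k := by
    apply le_antisymm
    · rw [← hEc]; exact xrank_le hEX hq'E
    · have hmem := Nat.sInf_mem (s := {k | ∃ S : Finset (PP K ι), ↑S ⊆ X ∧ S.card = k ∧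
        q' ∈ projSpan (S : Set (PP K ι))}) ⟨k, A.erase a, hEX, hEc, hq'E⟩
      obtain ⟨S, hS, hSc, hSq⟩ := hmem
      have := hlow' S hS hSq
      rw [hSc] at this
      exact this
  have hnot : ∀ S ∈ decompositions X q', a ∉ S ∧ (insert a S).card = k + 1 := by
    rintro S ⟨hS, hSc, hSq⟩
    have h1 := hlow _ (hinsX S hS) (hins S hS hSq)
    have haS : a ∉ S := by
      intro haS
      rw [Finset.insert_eq_of_mem haS] at h1
      omega
    refine ⟨haS, ?_⟩
    rw [Finset.card_insert_of_notMem haS]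
    omega
  refine ⟨hfin.toFinset.image (fun S => insert a S), ?_, ?_, ?_⟩
  · rw [Finset.card_image_of_injOn, ← Set.ncard_eq_toFinset_card _ hfin, hcard]
    intro S hS T hT hST
    have h1 := hnot S (by simpa using hS)
    have h2 := hnot T (by simpa using hT)
    have := congrArg (fun U => Finset.erase U a) hST
    simpa [Finset.erase_insert h1.1, Finset.erase_insert h2.1] using this
  · rw [Finset.mem_image]
    refine ⟨A.erase a, ?_, Finset.insert_erase ha⟩
    rw [Set.Finite.mem_toFinset]
    exact ⟨hEX, by rw [hEc, hq'r], hq'E⟩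
  · intro T hT
    rw [Finset.mem_image] at hT
    obtain ⟨S, hS, rfl⟩ := hT
    rw [Set.Finite.mem_toFinset] at hS
    refine ⟨⟨hinsX S hS.1, ?_, hins S hS.1 hS.2.2⟩, Finset.mem_insert_self a S⟩
    rw [(hnot S hS).2, hq]

lemma acl_powSet {S : Set (ι → K)} (h : ContactLoci.acl S ⊆ S) (m : ℕ) :
    ContactLoci.acl (powSet S m) ⊆ powSet S m := by
  intro u hu j
  apply h
  intro f hf
  have := hu (MvPolynomial.rename (fun i => (j, i)) f) (fun s hs => by
    rw [MvPolynomial.eval_rename]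
    exact hf _ (hs j))
  rw [MvPolynomial.eval_rename] at this
  exact this

/-- **Proposition (propa1).**  Assume `dim σ_{k+1}(X) = (k+1)(n+1) - 1 ≤ r` and that
the `k`-th secant degree `α` of `X` satisfies `α > 1`.  Then, for a general
`q ∈ σ_{k+1}(X)`, for every `A ∈ 𝒮(q,X)` and every `a ∈ A`, there are at least `α`
elements of `𝒮(q,X)` (one of them being `A`) containing `a`.
(Valid over an algebraically closed field of arbitrary characteristic.) -/
theorem statement1 {K : Type*} [Field K] [IsAlgClosed K]
    {ι : Type*} [Fintype ι] (r n k α : ℕ) (hι : Fintype.card ι = r + 1)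
    (X : Set (PP K ι)) (hX : IsIntegralVariety X) (hXnd : Nondegenerate X)
    (hXdim : zdim X = ((n : ℕ∞) : WithBot ℕ∞)) (hk : 1 ≤ k)
    (hsec : zdim (secant (k + 1) X) =
      ((((k + 1) * (n + 1) - 1 : ℕ) : ℕ∞) : WithBot ℕ∞))
    (hle : (k + 1) * (n + 1) - 1 ≤ r)
    (hdeg : HasSecantDegree X k α) (hα : 1 < α) :
    HoldsGenerically (secant (k + 1) X) fun q =>
      ∀ A ∈ decompositions X q, ∀ a ∈ A,
        ∃ B : Finset (Finset (PP K ι)), B.card = α ∧ A ∈ B ∧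
          ∀ S ∈ B, S ∈ decompositions X q ∧ a ∈ S := by
  have hinf : Infinite K := IsAlgClosed.instInfinite
  obtain ⟨Y, hYc, hYn, hYp⟩ := hdeg
  have hne : X.Nonempty := hX.2.1
  obtain ⟨fY, hfY, hfY'⟩ := exists_van hYc
    (fun h => hYn (Set.sInter_subset_of_mem ⟨hYc, h⟩) :
      ¬ {q | ∃ S : Finset (PP K ι), ↑S ⊆ X ∧ S.card = k ∧ q ∈ projSpan (S : Set (PP K ι))} ⊆ Y)
  have hu0 : ∃ u0 : Fin k → ι → K, (∀ j, u0 j ∈ coneOf X) ∧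
      MvPolynomial.eval (∑ j, u0 j) fY ≠ 0 := by
    unfold Van at hfY'
    push Not at hfY'
    obtain ⟨v0, hv0, hne0⟩ := hfY'
    obtain ⟨q0, ⟨S0, hS0, hS0c, hq0⟩, hvq0⟩ := mem_cone.1 hv0
    obtain ⟨w, hw, hws⟩ := mem_vspan_finset S0 v0 (hq0 hvq0)
    obtain ⟨u, hu, hus⟩ := exists_sum hne w hw S0 k hS0c.le hS0
    exact ⟨u, hu, by rw [hus, hws]; exact hne0⟩
  obtain ⟨u0, hu0, hfu0⟩ := hu0
  obtain ⟨x0, hx0⟩ := id hne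
  obtain ⟨i0, hi0⟩ := Function.ne_iff.1 x0.rep_nonzero
  set S := powSet (coneOf X) (k + 1) with hSdef
  have hSirr : Irr S := (irr_cone hX.2).powSet (k + 1)
  have hScl : ContactLoci.acl S ⊆ S := acl_powSet (acl_cone hX.1 hne) (k + 1)
  obtain ⟨d, hd⟩ : ∃ d, (k + 1) * (n + 1) = d + 2 := by
    refine ⟨(k + 1) * (n + 1) - 2, ?_⟩
    have : (k + 1) * 1 ≤ (k + 1) * (n + 1) := Nat.mul_le_mul_left _ (by omega)
    omega
  have hSd : DLE S (d + 1 + 1) := by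
    have := dle_pow hX hXdim (k + 1)
    rwa [hd] at this
  let H2 : MvPolynomial (Fin (k + 1) × ι) K :=
    MvPolynomial.bind₁ (fun i => ∑ j : Fin k, MvPolynomial.X (j.succ, i)) fY
  have hH2 : ∀ u : Fin (k + 1) × ι → K, MvPolynomial.eval u H2 =
      MvPolynomial.eval (∑ j : Fin k, fun i => u (j.succ, i)) fY := by
    intro u
    rw [eval_bind]
    congr 2
    funext i
    simp
  let H : MvPolynomial (Fin (k + 1) × ι) K := MvPolynomial.X (0, i0) * H2
  have hHv : ¬ Van S H := by
    intro h
    have h1 := h (fun p => (Fin.cons x0.rep u0 : Fin (k + 1) → ι → K) p.1 p.2) (by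
      intro j
      refine Fin.cases ?_ (fun j => ?_) j
      · exact mem_cone.2 ⟨x0, hx0, rep_mem x0⟩
      · exact hu0 j)
    rw [map_mul, MvPolynomial.eval_X, hH2] at h1
    rcases mul_eq_zero.1 h1 with h2 | h2
    · exact hi0 h2
    · exact hfu0 h2
  let G : ι → MvPolynomial (Fin (k + 1) × ι) K := fun i => ∑ j, MvPolynomial.X (j, i)
  have hG : ∀ u : Fin (k + 1) × ι → K, (fun i => MvPolynomial.eval u (G i)) =
      ∑ j, fun i => u (j, i) := by
    intro u
    funext i
    simp [G]
  obtain ⟨f, hf, hfi⟩ := chevalley hSirr hScl G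
  have hBd := DLE.image (DLE.cut hSirr hSd H hHv) G
  set Bs := (fun s i => MvPolynomial.eval s (G i)) '' {s ∈ S | MvPolynomial.eval s H = 0} with hBs
  set C := (fun s i => MvPolynomial.eval s (G i)) '' S with hC
  have hCd : DLE {v ∈ ContactLoci.acl C | MvPolynomial.eval v f = 0} (d + 1) :=
    DLE.cut (Irr.image hSirr G).acl (DLE.image hSd G).acl f
      (fun h => hf fun v hv => h v (subset_acl _ hv))
  have hsecC : coneOf (secant (k + 1) X) ⊆ ContactLoci.acl C := by
    intro v hv g hg
    obtain ⟨x, hx, hvx⟩ := mem_cone.1 hv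
    rw [secant, zclosure_eq] at hx
    refine hx g ?_ v hvx
    intro v1 hv1
    apply hg
    obtain ⟨q0, ⟨S0, hS0, hS0c, hq0⟩, hvq0⟩ := mem_cone.1 hv1
    obtain ⟨w, hw, hws⟩ := mem_vspan_finset S0 v1 (hq0 hvq0)
    obtain ⟨u, hu, hus⟩ := exists_sum hne w hw S0 (k + 1) hS0c.le hS0
    refine ⟨fun p => u p.1 p.2, fun j => hu j, ?_⟩
    rw [← hws, ← hus]
    exact hG _
  refine ⟨zeroLocus {f} ∪ zeroLocus {g | Van Bs g},
    (isZClosed_zeroLocus _).union (isZClosed_zeroLocus _), ?_, ?_⟩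
  · intro hsub
    have hdle : DLE (coneOf (zclosure (secant (k + 1) X))) (d + 1) := by
      have hsc : IsZClosed (secant (k + 1) X) := isZClosed_zclosure _
      rw [hsc.zclosure_eq]
      refine (hCd.union hBd.acl).mono ?_
      intro v hv
      obtain ⟨x, hx, hvx⟩ := mem_cone.1 hv
      rcases hsub hx with h | h
      · exact Or.inl ⟨hsecC hv, h f rfl v hvx⟩
      · exact Or.inr fun g hg => h g hg v hvx
    have h1 := zdim_le hdle
    rw [hsec, hd] at h1
    have h2 : d + 2 - 1 ≤ d := by exact_mod_cast h1
    omega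
  · rintro q ⟨hqs, hqY⟩
    rw [Set.mem_union, not_or] at hqY
    obtain ⟨hq1, hq2⟩ := hqY
    have hq2' : ∃ v ∈ q.submodule, v ∉ Bs := by
      by_contra hcon
      push Not at hcon
      exact hq2 fun g hg v hv => hg v (hcon v hv)
    obtain ⟨v, hv, hvB⟩ := hq2'
    have hv0 : v ≠ 0 := by
      rintro rfl
      apply hvB
      refine ⟨0, ⟨fun j => zero_mem_cone hne, ?_⟩, ?_⟩
      · simp [H]
      · beta_reduce
        rw [hG]
        funext i
        simp
    have hrank : xrank X q ≤ k + 1 := by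
      have : ∃ v1 ∈ q.submodule, v1 ≠ 0 ∧ MvPolynomial.eval v1 f ≠ 0 := by
        by_contra hcon
        push Not at hcon
        apply hq1
        rw [mem_zeroLocus_iff]
        intro g hg
        rw [Set.mem_singleton_iff.1 hg]
        have h1 : Polynomial.X * lin q.rep f = 0 := by
          apply Polynomial.funext
          intro t
          rw [Polynomial.eval_mul, Polynomial.eval_X, eval_lin, Polynomial.eval_zero]
          by_cases ht : t = 0
          · rw [ht, zero_mul]
          · rw [hcon (t • q.rep) ((mem_sub_iff _ _).2 ⟨t, rfl⟩)
              (smul_ne_zero ht q.rep_nonzero), mul_zero]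
        exact (mul_eq_zero.1 h1).resolve_left Polynomial.X_ne_zero
      obtain ⟨v1, hv1, h0, hfv1⟩ := this
      obtain ⟨s, hs, hsv⟩ := hfi v1 (hsecC (mem_cone.2 ⟨q, hqs, hv1⟩)) hfv1
      have hsv' : ∑ j, (fun i => s (j, i)) = v1 := by rw [← hG]; exact hsv
      exact xrank_le_of_sum (fun j i => s (j, i)) hs hv1 h0 hsv'
    refine pointwise hne hk hrank hv hv0 hfY i0 ?_ hYp hα
    intro u hu hus
    have hH : MvPolynomial.eval (fun p : Fin (k + 1) × ι => u p.1 p.2) H ≠ 0 := by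
      intro h
      apply hvB
      refine ⟨fun p => u p.1 p.2, ⟨fun j => hu j, h⟩, ?_⟩
      rw [← hus]
      exact hG _
    rw [map_mul, MvPolynomial.eval_X, hH2] at hH
    exact ⟨left_ne_zero_of_mul hH, right_ne_zero_of_mul hH⟩

end ContactLoci
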